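/- For all j, m ∈ ℤ with j, m ≥ 0 and all k, n ∈ ℤ, ∫_S ψ_{j,k}(z) conj(ψ_{m,n}(z)) e^{−ν|z|²} dm(z) = δ_{j,m} δ_{k,n}; that is, the family (ψ_{m,n})_{m≥0, n∈ℤ} is an orthonormal system for the inner product ⟨f,g⟩ = ∫_S f(z) conj(g(z)) e^{−ν|z|²} dm(z). -/

import Mathlib

open Complex MeasureTheory

/-- The physicists' Hermite polynomials, defined by `H₀ = 1` and
`H_{m+1}(x) = 2x H_m(x) − H_m'(x)`. -/
noncomputable def physHermite : ℕ → Polynomial ℝ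
  | 0 => 1
  | m + 1 => 2 * Polynomial.X * physHermite m - Polynomial.derivative (physHermite m)

/-- `ψ_{m,n}(z) = (2^m m!)^{−1/2} (2ν/π)^{1/4} e^{−(π²/ν)(n+α)²}
e^{(ν/2)z² + 2πi(α+n)z} H_m(√(2ν) y + √(2/ν) π(n+α))`, where `z = x + iy`. -/
noncomputable def psiMN (α ν : ℝ) (m : ℕ) (n : ℤ) (z : ℂ) : ℂ :=
  ((((2 : ℝ) ^ m * Nat.factorial m) ^ (-(1 : ℝ) / 2) *
      (2 * ν / Real.pi) ^ ((1 : ℝ) / 4) *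
      Real.exp (-(Real.pi ^ 2 / ν) * (n + α) ^ 2) : ℝ) : ℂ) *
    Complex.exp (ν / 2 * z ^ 2 + 2 * Real.pi * Complex.I * (α + n) * z) *
    (((physHermite m).eval
        (Real.sqrt (2 * ν) * z.im + Real.sqrt (2 / ν) * Real.pi * (n + α)) : ℝ) : ℂ)

/-- The derivative of `H_{m+1}` is `2 (m + 1) H_m`. -/
theorem derivative_physHermite_succ (m : ℕ) :
    Polynomial.derivative (physHermite (m + 1)) =
      Polynomial.C (2 * ((m : ℝ) + 1)) * physHermite m := by
  induction m with
  | zero => simp [physHermite, ← Polynomial.C_ofNat]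
  | succ m ih =>
    have hsucc : physHermite (m + 1 + 1) =
        2 * Polynomial.X * physHermite (m + 1) -
          Polynomial.derivative (physHermite (m + 1)) := rfl
    rw [hsucc, ih]
    simp only [Polynomial.derivative_sub, Polynomial.derivative_mul, ih,
      Polynomial.derivative_C, Polynomial.derivative_X, Polynomial.derivative_ofNat]
    have hdef : physHermite (m + 1) =
        2 * Polynomial.X * physHermite m - Polynomial.derivative (physHermite m) := rfl
    rw [hdef]
    simp only [Polynomial.C_mul, Polynomial.C_add, Polynomial.C_1, Nat.cast_add, Nat.cast_one,
      Polynomial.C_ofNat]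
    ring

theorem integrable_polynomial_mul_gaussian (p : Polynomial ℝ) :
    Integrable fun t : ℝ => p.eval t * Real.exp (-t ^ 2) := by
  induction p using Polynomial.induction_on' with
  | add p q hp hq =>
    simp only [Polynomial.eval_add, add_mul]
    exact hp.add hq
  | monomial n a =>
    have h := (integrable_rpow_mul_exp_neg_mul_sq (b := 1) one_pos (s := n)
      (by linarith [n.cast_nonneg (α := ℝ)])).const_mul a
    simpa [Real.rpow_natCast, mul_assoc] using h

theorem hasDerivAt_physHermite_mul_gaussian (m : ℕ) (t : ℝ) :
    HasDerivAt (fun t : ℝ => (physHermite m).eval t * Real.exp (-t ^ 2))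
      (-((physHermite (m + 1)).eval t * Real.exp (-t ^ 2))) t := by
  have h := ((physHermite m).hasDerivAt t).mul ((hasDerivAt_pow 2 t).neg.exp)
  refine h.congr_deriv ?_
  simp [physHermite]
  ring

/-- Integration by parts against the Gaussian moves a derivative off the Hermite polynomial. -/
theorem integral_polynomial_mul_physHermite_succ (p : Polynomial ℝ) (m : ℕ) :
    ∫ t : ℝ, p.eval t * ((physHermite (m + 1)).eval t * Real.exp (-t ^ 2)) =
      ∫ t : ℝ, p.derivative.eval t * ((physHermite m).eval t * Real.exp (-t ^ 2)) := by
  have hint (q r : Polynomial ℝ) :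
      Integrable fun t : ℝ => q.eval t * (r.eval t * Real.exp (-t ^ 2)) := by
    simpa [mul_assoc] using integrable_polynomial_mul_gaussian (q * r)
  have h := integral_mul_deriv_eq_deriv_mul_of_integrable
    (u := fun t => p.eval t) (fun t _ => p.hasDerivAt t)
    (fun t _ => hasDerivAt_physHermite_mul_gaussian m t)
    (by simpa [Pi.mul_def] using (hint p (physHermite (m + 1))).neg)
    (hint _ _) (hint _ _)
  simpa [integral_neg] using h

/-- Orthogonality of the Hermite polynomials for the Gaussian weight. -/
theorem integral_physHermite_mul_physHermite (j m : ℕ) :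
    ∫ t : ℝ, (physHermite j).eval t * ((physHermite m).eval t * Real.exp (-t ^ 2)) =
      if j = m then 2 ^ m * (Nat.factorial m : ℝ) * √Real.pi else 0 := by
  induction m generalizing j with
  | zero =>
    cases j with
    | zero => simpa [physHermite] using integral_gaussian 1
    | succ j =>
      have h := integral_polynomial_mul_physHermite_succ 1 j
      simp only [Polynomial.derivative_one, Polynomial.eval_one, Polynomial.eval_zero, one_mul,
        zero_mul, integral_zero] at h
      simpa [physHermite] using h
  | succ m ih =>
    rw [integral_polynomial_mul_physHermite_succ]
    cases j with
    | zero => simp [physHermite]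
    | succ j =>
      simp only [derivative_physHermite_succ, Polynomial.eval_mul, Polynomial.eval_C, mul_assoc]
      rw [integral_const_mul, integral_const_mul, ih]
      by_cases h : j = m
      · simp [h, Nat.factorial_succ]
        ring
      · simp [h]

theorem exp_mul_conj_exp_mul_weight (α ν : ℝ) (k n : ℤ) (z : ℂ) :
    Complex.exp (ν / 2 * z ^ 2 + 2 * Real.pi * I * (α + k) * z) *
        (starRingEnd ℂ) (Complex.exp (ν / 2 * z ^ 2 + 2 * Real.pi * I * (α + n) * z)) *
        Real.exp (-ν * normSq z) =
      Complex.exp (((k - n : ℤ) * (2 * Real.pi * I) : ℂ) * z.re) *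
        Real.exp (-2 * ν * z.im ^ 2 - 2 * Real.pi * (2 * α + k + n) * z.im) := by
  rw [← exp_conj, ofReal_exp, ofReal_exp, ← Complex.exp_add, ← Complex.exp_add,
    ← Complex.exp_add]
  congr 1
  obtain ⟨x, y⟩ := z
  simp only [Complex.mk_eq_add_mul_I, normSq_add_mul_I, map_add, map_mul, map_pow, map_div₀,
    conj_ofReal, conj_I, map_ofNat, map_intCast]
  simp
  linear_combination (ν * y ^ 2 + 2 * Real.pi * (2 * α + k + n) * y : ℂ) * I_sq

/-- The factor depending on `y = Im z` of the integrand of `⟨ψ_{j,k}, ψ_{m,n}⟩`. -/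
noncomputable def imProfile (α ν : ℝ) (j m : ℕ) (k n : ℤ) (y : ℝ) : ℝ :=
  ((2 : ℝ) ^ j * Nat.factorial j) ^ (-(1 : ℝ) / 2) *
      ((2 : ℝ) ^ m * Nat.factorial m) ^ (-(1 : ℝ) / 2) *
      ((2 * ν / Real.pi) ^ ((1 : ℝ) / 4)) ^ 2 *
    (Real.exp (-(Real.pi ^ 2 / ν) * (k + α) ^ 2) *
      Real.exp (-(Real.pi ^ 2 / ν) * (n + α) ^ 2) *
      Real.exp (-2 * ν * y ^ 2 - 2 * Real.pi * (2 * α + k + n) * y)) *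
    ((physHermite j).eval (√(2 * ν) * y + √(2 / ν) * Real.pi * (k + α)) *
      (physHermite m).eval (√(2 * ν) * y + √(2 / ν) * Real.pi * (n + α)))

/-- On `z = x + iy` the integrand is a character in `x` times a real function of `y`. -/
theorem psiMN_mul_conj_psiMN_mul_weight (α ν : ℝ) (j m : ℕ) (k n : ℤ) (z : ℂ) :
    psiMN α ν j k z * (starRingEnd ℂ) (psiMN α ν m n z) * Real.exp (-ν * normSq z) =
      Complex.exp (((k - n : ℤ) * (2 * Real.pi * I) : ℂ) * z.re) *
        (imProfile α ν j m k n z.im : ℂ) := by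
  have h := exp_mul_conj_exp_mul_weight α ν k n z
  unfold psiMN imProfile
  simp only [map_mul, conj_ofReal]
  generalize Complex.exp (ν / 2 * z ^ 2 + 2 * Real.pi * I * (α + k) * z) = a at *
  generalize (starRingEnd ℂ) (Complex.exp (ν / 2 * z ^ 2 + 2 * Real.pi * I * (α + n) * z)) = b at *
  generalize Complex.exp (((k - n : ℤ) * (2 * Real.pi * I) : ℂ) * z.re) = e at *
  generalize Real.exp (-ν * normSq z) = w at *
  generalize Real.exp (-2 * ν * z.im ^ 2 - 2 * Real.pi * (2 * α + k + n) * z.im) = g at *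
  generalize (physHermite j).eval _ = hj
  generalize (physHermite m).eval _ = hm
  simp only [ofReal_mul, ofReal_pow]
  linear_combination
    ((((2 : ℝ) ^ j * Nat.factorial j) ^ (-(1 : ℝ) / 2) : ℝ) *
      (((2 : ℝ) ^ m * Nat.factorial m) ^ (-(1 : ℝ) / 2) : ℝ) *
      (((2 * ν / Real.pi) ^ ((1 : ℝ) / 4) : ℝ) : ℂ) ^ 2 *
      Real.exp (-(Real.pi ^ 2 / ν) * (k + α) ^ 2) *
      Real.exp (-(Real.pi ^ 2 / ν) * (n + α) ^ 2) * hj * hm) * h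

/-- Fubini on the strip for a product of a function of `Re z` and a function of `Im z`. -/
theorem integral_strip_mul (f g : ℝ → ℂ) :
    ∫ z in {z : ℂ | z.re ∈ Set.Icc (0 : ℝ) 1}, f z.re * g z.im =
      (∫ x in (0 : ℝ)..1, f x) * ∫ y, g y := by
  have hset : {z : ℂ | z.re ∈ Set.Icc (0 : ℝ) 1} =
      measurableEquivRealProd ⁻¹' (Set.Icc (0 : ℝ) 1 ×ˢ Set.univ) := by
    ext z
    simp [measurableEquivRealProd_apply]
  have h := volume_preserving_equiv_real_prod.setIntegral_preimage_emb
    measurableEquivRealProd.measurableEmbedding (fun p : ℝ × ℝ => f p.1 * g p.2)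
    (Set.Icc (0 : ℝ) 1 ×ˢ Set.univ)
  simp only [measurableEquivRealProd_apply] at h
  rw [hset, h, Measure.volume_eq_prod, setIntegral_prod_mul, Measure.restrict_univ,
    intervalIntegral.integral_of_le zero_le_one, integral_Icc_eq_integral_Ioc]

theorem integral_exp_int_mul_two_pi_mul_I (l : ℤ) :
    ∫ x in (0 : ℝ)..1, Complex.exp ((l * (2 * Real.pi * I) : ℂ) * x) =
      if l = 0 then 1 else 0 := by
  split_ifs with hl
  · simp [hl]
  · rw [integral_exp_mul_complex (by simp [hl, Real.pi_ne_zero])]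
    simp [exp_int_mul_two_pi_mul_I]

theorem completed_square_gaussian {ν : ℝ} (hν : 0 < ν) (β y : ℝ) :
    Real.exp (-(Real.pi ^ 2 / ν) * β ^ 2) * Real.exp (-(Real.pi ^ 2 / ν) * β ^ 2) *
        Real.exp (-2 * ν * y ^ 2 - 2 * Real.pi * (2 * β) * y) =
      Real.exp (-(√(2 * ν) * y + √(2 / ν) * Real.pi * β) ^ 2) := by
  have h₁ : √(2 * ν) ^ 2 = 2 * ν := Real.sq_sqrt (by positivity)
  have h₂ : √(2 / ν) ^ 2 = 2 / ν := Real.sq_sqrt (by positivity)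
  have h₃ : √(2 * ν) * √(2 / ν) = 2 := by
    rw [← Real.sqrt_mul (by positivity), show 2 * ν * (2 / ν) = 2 ^ 2 by field_simp,
      Real.sqrt_sq zero_le_two]
  rw [← Real.exp_add, ← Real.exp_add]
  congr 1
  linear_combination y ^ 2 * h₁ + Real.pi ^ 2 * β ^ 2 * h₂ + 2 * Real.pi * β * y * h₃

theorem integral_comp_mul_add_real (f : ℝ → ℝ) {a : ℝ} (ha : 0 < a) (b : ℝ) :
    ∫ y, f (a * y + b) = a⁻¹ * ∫ t, f t := by
  rw [Measure.integral_comp_mul_left (fun y => f (y + b)) a, integral_add_right_eq_self,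
    abs_of_pos (inv_pos.mpr ha), smul_eq_mul]

theorem hermite_normalization {ν : ℝ} (hν : 0 < ν) (m : ℕ) :
    ((2 : ℝ) ^ m * Nat.factorial m) ^ (-(1 : ℝ) / 2) *
        ((2 : ℝ) ^ m * Nat.factorial m) ^ (-(1 : ℝ) / 2) *
        ((2 * ν / Real.pi) ^ ((1 : ℝ) / 4)) ^ 2 *
      ((√(2 * ν))⁻¹ * (2 ^ m * (Nat.factorial m : ℝ) * √Real.pi)) = 1 := by
  have hc : (0 : ℝ) < 2 ^ m * Nat.factorial m := by positivity
  have hq : 0 < 2 * ν / Real.pi := by positivity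
  rw [← Real.rpow_add hc, ← Real.rpow_natCast (_ ^ _), ← Real.rpow_mul hq.le]
  rw [show -(1 : ℝ) / 2 + -(1 : ℝ) / 2 = -1 by norm_num,
    show (1 : ℝ) / 4 * (2 : ℕ) = 1 / 2 by norm_num, ← Real.sqrt_eq_rpow, Real.rpow_neg_one,
    Real.sqrt_div (by positivity)]
  have : √(2 * ν) ≠ 0 := by positivity
  field_simp

theorem integral_imProfile_self (α : ℝ) {ν : ℝ} (hν : 0 < ν) (j m : ℕ) (k : ℤ) :
    ∫ y, imProfile α ν j m k k y = if j = m then 1 else 0 := by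
  have hscale := integral_comp_mul_add_real
    (fun t => (physHermite j).eval t * ((physHermite m).eval t * Real.exp (-t ^ 2)))
    (a := √(2 * ν)) (by positivity) (√(2 / ν) * Real.pi * (k + α))
  rw [integral_physHermite_mul_physHermite] at hscale
  simp only [imProfile, show 2 * α + k + k = 2 * (k + α) by ring, completed_square_gaussian hν,
    mul_assoc (_ * _ ^ 2 : ℝ), mul_comm (Real.exp _), mul_assoc ((physHermite j).eval _)]
  rw [integral_const_mul, hscale]
  split_ifs with hjm
  · subst hjm
    exact hermite_normalization hν j
  · simp

/-- The family `(ψ_{m,n})_{m≥0, n∈ℤ}` is orthonormal for the inner product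
`⟨f,g⟩ = ∫_S f(z) conj(g(z)) e^{−ν|z|²} dm(z)` on the strip `S = {0 ≤ Re z ≤ 1}`. -/
theorem stmt_16 (α ν : ℝ) (hν : 0 < ν) (j m : ℕ) (k n : ℤ) :
    (∫ z in {z : ℂ | z.re ∈ Set.Icc (0 : ℝ) 1},
        psiMN α ν j k z * (starRingEnd ℂ) (psiMN α ν m n z) *
          Real.exp (-ν * Complex.normSq z))
      = if j = m ∧ k = n then 1 else 0 := by
  simp only [psiMN_mul_conj_psiMN_mul_weight]
  rw [integral_strip_mul (fun x => Complex.exp (((k - n : ℤ) * (2 * Real.pi * I) : ℂ) * x))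
      (fun y => (imProfile α ν j m k n y : ℂ)),
    integral_exp_int_mul_two_pi_mul_I]
  by_cases hkn : k = n
  · subst hkn
    rw [if_pos (sub_self k), one_mul, integral_complex_ofReal, integral_imProfile_self α hν]
    split_ifs <;> simp_all
  · simp [hkn, sub_eq_zero]
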